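/- arXiv:2303.02746 — 2 statements merged into one kernel-verified Lean document; each statement's English description precedes it below -/
import Mathlib

section
/- Suppose that, for each t = 1, …, T, the function f_t is M_t-relatively Lipschitz continuous and μ_t-relatively strongly convex w.r.t. the prox-function h, with μ_{1:t} = Σ_{s=1}^t μ_s > 0 for all t. Then the iterates of online mirror descent with step sizes η_{t+1} = 1/μ_{1:t} satisfy Regret_T ≤ Σ_{t=1}^T M_t² / μ_{1:t}. -/
open scoped RealInnerProductSpace
open Finset

/-- The Bregman divergence `V(y,x) = h(y) − h(x) − ⟨∇h(x), y − x⟩`. -/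
noncomputable def breg {E : Type*} [NormedAddCommGroup E] [InnerProductSpace ℝ E]
    [CompleteSpace E] (h : E → ℝ) (y x : E) : ℝ :=
  h y - h x - ⟪gradient h x, y - x⟫

/-- `f` is `M`-relatively Lipschitz continuous w.r.t. the prox-function `h` on `Q`. -/
noncomputable def RelLipschitz {E : Type*} [NormedAddCommGroup E] [InnerProductSpace ℝ E]
    [CompleteSpace E] (h : E → ℝ) (Q : Set E) (M : ℝ) (f : E → ℝ) : Prop :=
  ∀ x ∈ Q, ∀ y ∈ Q, 0 ≤ ⟪gradient f x, y - x⟫ + M * Real.sqrt (2 * breg h y x)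

/-- `f` is `μ`-relatively strongly convex w.r.t. the prox-function `h` on `Q`. -/
noncomputable def RelStrongConvex {E : Type*} [NormedAddCommGroup E] [InnerProductSpace ℝ E]
    [CompleteSpace E] (h : E → ℝ) (Q : Set E) (μ : ℝ) (f : E → ℝ) : Prop :=
  ∀ x ∈ Q, ∀ y ∈ Q, f y + ⟪gradient f y, x - y⟫ + μ * breg h x y ≤ f x

/-- One mirror-descent step from `x` with step size `η` in the direction `v`: there is
`y` with `∇h(y) = ∇h(x) − η·v`, and the next iterate `x'` is the Bregman projection of
`y` onto `Q`. -/
noncomputable def MDStepV {E : Type*} [NormedAddCommGroup E] [InnerProductSpace ℝ E]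
    [CompleteSpace E] (h : E → ℝ) (Q : Set E) (η : ℝ) (v : E) (x x' : E) : Prop :=
  ∃ y : E, gradient h y = gradient h x - η • v ∧ x' ∈ Q ∧
    IsMinOn (fun z => breg h z y) Q x'

theorem aux_inner {E : Type*} [NormedAddCommGroup E] [InnerProductSpace ℝ E]
    [CompleteSpace E] {h : E → ℝ} (hd : Differentiable ℝ h) (x v : E) :
    fderiv ℝ h x v = ⟪gradient h x, v⟫ := by
  have := (hd x).hasGradientAt.hasFDerivAt.fderiv
  rw [this]; simp

theorem aux_nonneg {E : Type*} [NormedAddCommGroup E] [InnerProductSpace ℝ E]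
    [CompleteSpace E] {h : E → ℝ} (hd : Differentiable ℝ h) (hc : ConvexOn ℝ Set.univ h)
    (y x : E) : 0 ≤ breg h y x := by
  have hcv : ConvexOn ℝ Set.univ (h ∘ AffineMap.lineMap (k := ℝ) x y) :=
    hc.comp_affineMap _
  have hder : HasDerivAt (h ∘ AffineMap.lineMap (k := ℝ) x y) (fderiv ℝ h x (y - x)) 0 := by
    have h1 : HasFDerivAt h (fderiv ℝ h x) (AffineMap.lineMap (k := ℝ) x y (0:ℝ)) := by
      simpa using (hd x).hasFDerivAt
    exact h1.comp_hasDerivAt (0:ℝ) AffineMap.hasDerivAt_lineMap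
  have := hcv.le_slope_of_hasDerivAt (Set.mem_univ 0) (Set.mem_univ 1) one_pos hder
  rw [aux_inner hd] at this
  simp [slope_def_field, -map_sub, inner_sub_right] at this
  unfold breg
  rw [inner_sub_right]
  rw [aux_inner hd, aux_inner hd] at this
  linarith

theorem aux_opt {E : Type*} [NormedAddCommGroup E] [InnerProductSpace ℝ E]
    [CompleteSpace E] {h : E → ℝ} (hd : Differentiable ℝ h) {Q : Set E} (hQ : Convex ℝ Q)
    {y x' z : E} (hx' : x' ∈ Q) (hz : z ∈ Q) (hm : IsMinOn (fun z => breg h z y) Q x') :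
    0 ≤ ⟪gradient h x' - gradient h y, z - x'⟫ := by
  have h1 : HasFDerivAt (fun z => breg h z y) (fderiv ℝ h x' - innerSL ℝ (gradient h y)) x' := by
    unfold breg
    have h2 : HasFDerivAt (fun z => ⟪gradient h y, z - y⟫) (innerSL ℝ (gradient h y)) x' :=
      (innerSL ℝ (gradient h y)).hasFDerivAt.comp x' ((hasFDerivAt_id x').sub_const y)
    exact ((hd x').hasFDerivAt.sub_const _).sub h2
  have := hm.localize.hasFDerivWithinAt_nonneg h1.hasFDerivWithinAt
    (sub_mem_posTangentConeAt_of_segment_subset (hQ.segment_subset hx' hz))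
  rw [ContinuousLinearMap.sub_apply, aux_inner hd, innerSL_apply_apply] at this
  rw [inner_sub_left]; exact this

theorem aux_step {E : Type*} [NormedAddCommGroup E] [InnerProductSpace ℝ E]
    [CompleteSpace E] {h : E → ℝ} (hd : Differentiable ℝ h) (hc : ConvexOn ℝ Set.univ h)
    {Q : Set E} (hQ : Convex ℝ Q) {f : E → ℝ} {M μ S : ℝ} (hS : 0 < S)
    (hL : RelLipschitz h Q M f) (hSC : RelStrongConvex h Q μ f) {x x' z : E}
    (hx : x ∈ Q) (hz : z ∈ Q) (hst : MDStepV h Q (1 / S) (gradient f x) x x') :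
    f x - f z ≤ (S - μ) * breg h z x - S * breg h z x' + M ^ 2 / S := by
  obtain ⟨y, hy, hx', hm⟩ := hst
  have h1 := aux_opt hd hQ hx' hz hm
  have h2 := hL x hx x' hx'
  have h3 := hSC z hz x hx
  have h4 := aux_nonneg hd hc x' x
  have h5 : ⟪gradient h x' - gradient h x, z - x'⟫
      = breg h z x - breg h z x' - breg h x' x := by
    unfold breg
    simp only [inner_sub_left, inner_sub_right]; ring
  have h6 : ⟪gradient h x' - gradient h y, z - x'⟫
      = ⟪gradient h x' - gradient h x, z - x'⟫ + 1 / S * ⟪gradient f x, z - x'⟫ := by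
    rw [hy]
    simp only [inner_sub_left, real_inner_smul_left]; ring
  have h7 : ⟪gradient f x, z - x⟫ = ⟪gradient f x, z - x'⟫ + ⟪gradient f x, x' - x⟫ := by
    rw [← inner_add_right]; congr 1; abel
  rw [h6, h5] at h1
  have h8 : 0 ≤ S * (breg h z x - breg h z x' - breg h x' x) + ⟪gradient f x, z - x'⟫ := by
    have := mul_nonneg hS.le h1
    have e : S * (1 / S * ⟪gradient f x, z - x'⟫) = ⟪gradient f x, z - x'⟫ := by
      field_simp
    rw [mul_add, e] at this
    exact this
  have h9 : M * Real.sqrt (2 * breg h x' x) ≤ S * breg h x' x + M ^ 2 / S := by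
    have hs := Real.sq_sqrt (show 0 ≤ 2 * breg h x' x by linarith)
    set r := Real.sqrt (2 * breg h x' x)
    have e : breg h x' x = r ^ 2 / 2 := by linarith
    rw [e]
    have : S * (r ^ 2 / 2) + M ^ 2 / S - M * r
        = ((S * r - M) ^ 2 + M ^ 2) / (2 * S) := by
      field_simp; ring
    have : 0 ≤ ((S * r - M) ^ 2 + M ^ 2) / (2 * S) := by positivity
    linarith
  linarith

/-- Theorem 2 (General-Norm Online Gradient Descent, relatively strongly convex and
relatively Lipschitz-continuous case): with step sizes `η_{t+1} = 1/μ_{1:t}`,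
`Regret_T ≤ Σ_{t=1}^T M_t²/μ_{1:t}`. -/
theorem online_mirror_descent_regret
    {E : Type*} [NormedAddCommGroup E] [InnerProductSpace ℝ E] [FiniteDimensional ℝ E]
    (Q : Set E) (hQne : Q.Nonempty) (hQclosed : IsClosed Q) (hQconv : Convex ℝ Q)
    (h : E → ℝ) (hdiff : Differentiable ℝ h) (hconv : ConvexOn ℝ Set.univ h)
    (T : ℕ) (hT : 0 < T)
    (f : ℕ → E → ℝ) (hfdiff : ∀ t, Differentiable ℝ (f t))
    (hfconv : ∀ t, ConvexOn ℝ Set.univ (f t))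
    (M μ : ℕ → ℝ)
    (hMnn : ∀ t ∈ Finset.Icc 1 T, 0 ≤ M t)
    (hμpos : ∀ t ∈ Finset.Icc 1 T, 0 < ∑ s ∈ Finset.Icc 1 t, μ s)
    (hfLip : ∀ t ∈ Finset.Icc 1 T, RelLipschitz h Q (M t) (f t))
    (hfSC : ∀ t ∈ Finset.Icc 1 T, RelStrongConvex h Q (μ t) (f t))
    (x : ℕ → E) (hx1 : x 1 ∈ Q)
    (hstep : ∀ t ∈ Finset.Icc 1 T,
      MDStepV h Q (1 / ∑ s ∈ Finset.Icc 1 t, μ s) (gradient (f t) (x t)) (x t) (x (t + 1)))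
    (xs : E) (hxsQ : xs ∈ Q)
    (hxsmin : ∀ y ∈ Q, ∑ t ∈ Finset.Icc 1 T, f t xs ≤ ∑ t ∈ Finset.Icc 1 T, f t y) :
    ∑ t ∈ Finset.Icc 1 T, f t (x t) - ∑ t ∈ Finset.Icc 1 T, f t xs ≤
      ∑ t ∈ Finset.Icc 1 T, (M t) ^ 2 / ∑ s ∈ Finset.Icc 1 t, μ s := by
  have hxQ : ∀ t ∈ Finset.Icc 1 T, x t ∈ Q := by
    intro t ht
    rw [Finset.mem_Icc] at ht
    obtain ⟨n, rfl⟩ : ∃ n, t = n + 1 := ⟨t - 1, by omega⟩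
    rcases Nat.eq_zero_or_pos n with rfl | hn
    · exact hx1
    · obtain ⟨_, _, hq, _⟩ := hstep n (Finset.mem_Icc.2 ⟨hn, by omega⟩)
      exact hq
  have key : ∀ n, n ≤ T → ∑ t ∈ Finset.Icc 1 n, f t (x t) - ∑ t ∈ Finset.Icc 1 n, f t xs ≤
      ∑ t ∈ Finset.Icc 1 n, (M t) ^ 2 / ∑ s ∈ Finset.Icc 1 t, μ s
        - (∑ s ∈ Finset.Icc 1 n, μ s) * breg h xs (x (n + 1)) := by
    intro n
    induction n with
    | zero => simp
    | succ n ih =>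
      intro hn
      have ih := ih (by omega)
      have hm : n + 1 ∈ Finset.Icc 1 T := Finset.mem_Icc.2 ⟨by omega, hn⟩
      have st := aux_step hdiff hconv hQconv (hμpos _ hm) (hfLip _ hm) (hfSC _ hm)
        (hxQ _ hm) hxsQ (hstep _ hm)
      have e : ∑ s ∈ Finset.Icc 1 (n + 1), μ s - μ (n + 1) = ∑ s ∈ Finset.Icc 1 n, μ s := by
        rw [Finset.sum_Icc_succ_top (by omega)]; ring
      rw [e] at st
      rw [Finset.sum_Icc_succ_top (by omega) (fun t => f t (x t)),
        Finset.sum_Icc_succ_top (by omega) (fun t => f t xs),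
        Finset.sum_Icc_succ_top (by omega) (fun t => (M t) ^ 2 / ∑ s ∈ Finset.Icc 1 t, μ s)]
      linarith
  have h1 := key T le_rfl
  have h2 := mul_nonneg (hμpos T (Finset.mem_Icc.2 ⟨hT, le_rfl⟩)).le
    (aux_nonneg hdiff hconv xs (x (T + 1)))
  linarith
end

section
/- Under the same hypotheses (each f_t is M_t-relatively Lipschitz continuous and μ_t-relatively strongly convex w.r.t. h; d is M_d-relatively Lipschitz continuous, 1-relatively strongly convex, nonnegative on Q, with A² = sup_{x ∈ Q} d(x); the algorithm uses λ_t = ½·(√((μ_{1:t} + λ_{1:t−1})² + 8·M_t²/(A² + 2·M_d²)) − (μ_{1:t} + λ_{1:t−1})) and η_{t+1} = 1/(μ_{1:t} + λ_{1:t}) with μ_{1:t} + λ_{1:t} > 0), the regret of regularized online mirror descent satisfies Regret_T ≤ 2·inf over all nonnegative sequences λ_1*, …, λ_T* of [(A² + 2·M_d²)·λ*_{1:T} + Σ_{t=1}^T (M_t + λ_t*·M_d)²/(μ_{1:t} + λ*_{1:t})]. -/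
open scoped RealInnerProductSpace
open Finset

theorem romd_scalar_step {lam S L L' w e : ℝ} (hl : 0 ≤ lam) (hS : 0 < S) (hw : 0 < w)
    (hwe : w = S - (L' + lam) + L) (h1 : e ≤ lam * (1 + lam / (2 * S))) (h2 : e ≤ 7 / 4 * lam) :
    e ≤ 2 * (min L (L' + lam) - min L L') + lam * S / w := by
  have hterm : 0 ≤ lam * S / w := by positivity
  rcases le_total (L' + lam) L with c1 | c1
  · rw [min_eq_right c1, min_eq_right (by linarith)]; linarith
  rw [min_eq_left c1]
  have key : lam * (1 + (S - w) / S) ≤ lam * S / w := by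
    have : 1 + (S - w) / S ≤ S / w := by
      rw [le_div_iff₀ hw]
      have : (1 + (S - w) / S) * w = (2 * S * w - w * w) / S := by field_simp; ring
      rw [this, div_le_iff₀ hS]
      nlinarith [sq_nonneg (S - w)]
    calc _ ≤ lam * (S / w) := mul_le_mul_of_nonneg_left this hl
      _ = _ := by ring
  have hr : lam / (2 * S) = lam / S / 2 := by field_simp
  rw [hr] at h1
  set r := lam / S with hrd
  have hr0 : 0 ≤ r := by positivity
  have hrS : lam = r * S := by rw [hrd]; field_simp
  rcases le_total L L' with c2 | c2
  · rw [min_eq_left c2]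
    have : r ≤ (S - w) / S := by
      rw [hrd]; gcongr; linarith
    have := mul_le_mul_of_nonneg_left this hl
    nlinarith
  · rw [min_eq_right c2]
    rcases le_total r 1 with c3 | c3
    · have e1 : (S - w) / S = r - (L - L') / S := by rw [hrd, ← sub_div]; congr 1; linarith
      rw [e1] at key
      have e2 : lam * ((L - L') / S) = r * (L - L') := by rw [hrd]; field_simp
      nlinarith
    · have hlS : S ≤ lam := by rw [hrS]; nlinarith
      have e3 : L - L' = lam - S + w := by linarith
      rw [e3]
      have : 2 * S ≤ 2 * w + lam * S / w := by
        have : 2 * w + lam * S / w = (2 * w * w + lam * S) / w := by field_simp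
        rw [this, le_div_iff₀ hw]
        nlinarith [sq_nonneg (S - w)]
      linarith

theorem romd_scalar_bound {A2 Md lam S M u De B : ℝ} (hl : 0 ≤ lam) (hS : 0 < S)
    (hB : B = A2 + 2 * Md ^ 2) (hMd : 0 < Md) (hA : 0 ≤ A2)
    (hM : B * lam * S = 2 * M ^ 2) (hD1 : De ≤ A2) (hD2 : De ≤ Md ^ 2 / 2)
    (hu : u ^ 2 / 2 ≤ A2 + Md * u) (hu0 : 0 ≤ u) :
    lam * De + (M + lam * Md) * u - S * u ^ 2 / 2 ≤ B * (lam * (1 + lam / (2 * S))) ∧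
    lam * De + (M + lam * Md) * u - S * u ^ 2 / 2 ≤ B * (7 / 4 * lam) := by
  have hBd : lam * De ≤ lam * (B / 2) := mul_le_mul_of_nonneg_left (by nlinarith) hl
  constructor
  · have hq : (M + lam * Md) * u - S * u ^ 2 / 2 ≤ (M + lam * Md) ^ 2 / (2 * S) := by
      rw [le_div_iff₀ (by positivity)]
      nlinarith [sq_nonneg (M + lam * Md - S * u)]
    have hq2 : (M + lam * Md) ^ 2 / (2 * S) ≤ B * lam / 2 + B * lam * (lam / (2 * S)) := by
      have : B * lam / 2 + B * lam * (lam / (2 * S)) = (B * lam * S + B * lam * lam) / (2 * S) := by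
        field_simp
      rw [this]
      gcongr
      rw [hM]
      have : lam ^ 2 * (2 * Md ^ 2) ≤ lam ^ 2 * B :=
        mul_le_mul_of_nonneg_left (by linarith) (sq_nonneg _)
      nlinarith [sq_nonneg (M - lam * Md)]
    nlinarith
  · have hmu : Md * u ≤ B := by
      by_contra hc
      push Not at hc
      rw [hB] at hc
      have h1 : A2 < Md * (u - 2 * Md) := by nlinarith
      have h2 : 0 < u - 2 * Md := by
        by_contra h3
        push Not at h3
        nlinarith
      nlinarith
    have h3 : M * u - S * u ^ 2 / 2 ≤ B * lam / 4 := by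
      have : S * (M * u - S * u ^ 2 / 2) ≤ S * (B * lam / 4) := by
        nlinarith [sq_nonneg (M - S * u)]
      exact le_of_mul_le_mul_left this hS
    nlinarith [mul_le_mul_of_nonneg_left hmu hl]

section romd
variable {E : Type*} [NormedAddCommGroup E] [InnerProductSpace ℝ E] [CompleteSpace E]

theorem romd_grad_ineq {f : E → ℝ} (hd : Differentiable ℝ f) (hc : ConvexOn ℝ Set.univ f)
    (x y : E) : f x + ⟪gradient f x, y - x⟫ ≤ f y := by
  have hg : HasDerivAt (fun s : ℝ => f (AffineMap.lineMap x y s)) (⟪gradient f x, y - x⟫) 0 := by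
    have h1 := (hd x).hasGradientAt.hasFDerivAt
    have h2 : HasDerivAt (fun s : ℝ => (AffineMap.lineMap x y s : E)) (y - x) 0 :=
      AffineMap.hasDerivAt_lineMap
    have h3 : HasFDerivAt f (InnerProductSpace.toDual ℝ E (gradient f x))
        (AffineMap.lineMap x y (0:ℝ)) := by simpa using h1
    exact h3.comp_hasDerivAt (0:ℝ) h2
  have hcv : ConvexOn ℝ Set.univ (fun s : ℝ => f (AffineMap.lineMap x y s)) :=
    hc.comp_affineMap (AffineMap.lineMap x y)
  have := hcv.le_slope_of_hasDerivAt (Set.mem_univ (0:ℝ)) (Set.mem_univ (1:ℝ)) one_pos hg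
  simp only [slope, sub_zero, inv_one, one_smul, vsub_eq_sub, AffineMap.lineMap_apply_one,
    AffineMap.lineMap_apply_zero] at this
  linarith

theorem romd_breg_nonneg {h : E → ℝ} (hd : Differentiable ℝ h) (hc : ConvexOn ℝ Set.univ h)
    (x y : E) : 0 ≤ breg h y x := by
  have := romd_grad_ineq hd hc x y
  unfold breg; linarith

theorem romd_opt {h : E → ℝ} (hd : Differentiable ℝ h) {Q : Set E} (hQ : Convex ℝ Q)
    {y x' z : E} (hx' : x' ∈ Q) (hz : z ∈ Q) (hm : IsMinOn (fun z => breg h z y) Q x') :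
    0 ≤ ⟪gradient h x' - gradient h y, z - x'⟫ := by
  have h1 := (hd x').hasGradientAt.hasFDerivAt
  have h2 : HasFDerivAt (fun z => breg h z y)
      (InnerProductSpace.toDual ℝ E (gradient h x') - InnerProductSpace.toDual ℝ E (gradient h y)) x' := by
    have h3 := (InnerProductSpace.toDual ℝ E (gradient h y)).hasFDerivAt (x := x')
    have h4 := (h1.sub h3).add_const (- h y + ⟪gradient h y, y⟫)
    refine h4.congr_of_eventuallyEq (Filter.Eventually.of_forall fun z => ?_)
    simp [breg, inner_sub_right]; ring
  have := hm.localize.hasFDerivWithinAt_nonneg h2.hasFDerivWithinAt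
    (sub_mem_posTangentConeAt_of_segment_subset (hQ.segment_subset hx' hz))
  simpa [inner_sub_left] using this

/-- one step of mirror descent -/
theorem romd_md_step {h : E → ℝ} (hd : Differentiable ℝ h) {Q : Set E} (hQ : Convex ℝ Q)
    {S : ℝ} (hS : 0 < S) {g x x' z : E} (hz : z ∈ Q) (hst : MDStepV h Q (1 / S) g x x') :
    ⟪g, x - z⟫ ≤ S * (breg h z x - breg h z x') + ⟪g, x - x'⟫ - S * breg h x' x := by
  obtain ⟨y, hy, hx', hm⟩ := hst
  have h1 := romd_opt hd hQ hx' hz hm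
  rw [hy] at h1
  have h2 : breg h z x - breg h z x' - breg h x' x = ⟪gradient h x' - gradient h x, z - x'⟫ := by
    simp only [breg, inner_sub_left, inner_sub_right]; ring
  have h3 : ⟪gradient h x' - (gradient h x - (1 / S) • g), z - x'⟫
      = ⟪gradient h x' - gradient h x, z - x'⟫ + (1 / S) * ⟪g, z - x'⟫ := by
    rw [← sub_add, inner_add_left, real_inner_smul_left]
  rw [h3, ← h2] at h1
  have h4 : S * ((breg h z x - breg h z x' - breg h x' x) + (1 / S) * ⟪g, z - x'⟫)
    = S * (breg h z x - breg h z x' - breg h x' x) + ⟪g, z - x'⟫ := by field_simp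
  have h5 := mul_nonneg hS.le h1
  rw [h4] at h5
  simp only [inner_sub_right] at *
  linarith
end romd

/-- Theorem 3, second bound (Adaptive General-Norm Online Gradient Descent with
Regularization): with the adaptive choice of `λ_t` and `η_{t+1} = 1/(μ_{1:t} + λ_{1:t})`,
`Regret_T ≤ 2·inf_{λ* ≥ 0} [(A² + 2·M_d²)·λ*_{1:T} + Σ_t (M_t + λ_t*·M_d)²/(μ_{1:t} + λ*_{1:t})]`,
stated as the bound holding for every admissible nonnegative comparison sequence `λ*`. -/
theorem regularized_online_mirror_descent_regret_inf
    {E : Type*} [NormedAddCommGroup E] [InnerProductSpace ℝ E] [FiniteDimensional ℝ E]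
    (Q : Set E) (hQne : Q.Nonempty) (hQclosed : IsClosed Q) (hQconv : Convex ℝ Q)
    (h : E → ℝ) (hdiff : Differentiable ℝ h) (hconv : ConvexOn ℝ Set.univ h)
    (T : ℕ) (hT : 0 < T)
    (f : ℕ → E → ℝ) (hfdiff : ∀ t, Differentiable ℝ (f t))
    (hfconv : ∀ t, ConvexOn ℝ Set.univ (f t))
    (M μ : ℕ → ℝ)
    (hMnn : ∀ t ∈ Finset.Icc 1 T, 0 ≤ M t)
    (hfLip : ∀ t ∈ Finset.Icc 1 T, RelLipschitz h Q (M t) (f t))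
    (hfSC : ∀ t ∈ Finset.Icc 1 T, RelStrongConvex h Q (μ t) (f t))
    (d : E → ℝ) (hddiff : Differentiable ℝ d) (hdconv : ConvexOn ℝ Set.univ d)
    (Md A2 : ℝ)
    (hdLip : RelLipschitz h Q Md d) (hdSC : RelStrongConvex h Q 1 d)
    (hdnn : ∀ z ∈ Q, 0 ≤ d z) (hA2 : IsLUB (d '' Q) A2)
    (lam : ℕ → ℝ)
    (hlam : ∀ t ∈ Finset.Icc 1 T, lam t =
      (Real.sqrt (((∑ s ∈ Finset.Icc 1 t, μ s) + ∑ s ∈ Finset.Icc 1 (t - 1), lam s) ^ 2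
          + 8 * (M t) ^ 2 / (A2 + 2 * Md ^ 2))
        - ((∑ s ∈ Finset.Icc 1 t, μ s) + ∑ s ∈ Finset.Icc 1 (t - 1), lam s)) / 2)
    (hpos : ∀ t ∈ Finset.Icc 1 T,
      0 < (∑ s ∈ Finset.Icc 1 t, μ s) + ∑ s ∈ Finset.Icc 1 t, lam s)
    (x : ℕ → E) (hx1 : x 1 ∈ Q)
    (hstep : ∀ t ∈ Finset.Icc 1 T,
      MDStepV h Q (1 / ((∑ s ∈ Finset.Icc 1 t, μ s) + ∑ s ∈ Finset.Icc 1 t, lam s))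
        (gradient (f t) (x t) + lam t • gradient d (x t)) (x t) (x (t + 1)))
    (xs : E) (hxsQ : xs ∈ Q)
    (hxsmin : ∀ y ∈ Q, ∑ t ∈ Finset.Icc 1 T, f t xs ≤ ∑ t ∈ Finset.Icc 1 T, f t y) :
    ∀ lamStar : ℕ → ℝ,
      (∀ t ∈ Finset.Icc 1 T, 0 ≤ lamStar t) →
      (∀ t ∈ Finset.Icc 1 T,
        0 < (∑ s ∈ Finset.Icc 1 t, μ s) + ∑ s ∈ Finset.Icc 1 t, lamStar s) →
      ∑ t ∈ Finset.Icc 1 T, f t (x t) - ∑ t ∈ Finset.Icc 1 T, f t xs ≤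
        2 * ((A2 + 2 * Md ^ 2) * (∑ s ∈ Finset.Icc 1 T, lamStar s) +
          ∑ t ∈ Finset.Icc 1 T, (M t + lamStar t * Md) ^ 2 /
            ((∑ s ∈ Finset.Icc 1 t, μ s) + ∑ s ∈ Finset.Icc 1 t, lamStar s)) := by
  intro ls hls hlsp
  have hA2' : ∀ z ∈ Q, d z ≤ A2 := fun z hz => hA2.1 ⟨z, hz, rfl⟩
  have hA0 : 0 ≤ A2 := (hdnn _ hxsQ).trans (hA2' _ hxsQ)
  have hV := romd_breg_nonneg hdiff hconv
  have hxQ : ∀ t ∈ Finset.Icc 1 (T + 1), x t ∈ Q := by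
    intro t ht
    rw [Finset.mem_Icc] at ht
    obtain ⟨s, rfl⟩ : ∃ s, t = s + 1 := ⟨t - 1, by omega⟩
    rcases Nat.eq_zero_or_pos s with rfl | hs
    · exact hx1
    · obtain ⟨y, -, hy, -⟩ := hstep s (Finset.mem_Icc.2 ⟨hs, by omega⟩)
      exact hy
  have hxQ1 : ∀ t ∈ Finset.Icc 1 T, x t ∈ Q := fun t ht =>
    hxQ t (by rw [Finset.mem_Icc] at *; omega)
  have hxQ2 : ∀ t ∈ Finset.Icc 1 T, x (t + 1) ∈ Q := fun t ht =>
    hxQ (t + 1) (by rw [Finset.mem_Icc] at *; omega)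
  have hB0 : 0 ≤ A2 + 2 * Md ^ 2 := by positivity
  rcases le_or_gt Md 0 with hMd | hMd
  · have hd1 : ∀ a ∈ Q, ∀ b ∈ Q, d a + breg h b a ≤ d b := by
      intro a ha b hb
      have h1 := hdLip a ha b hb
      have h2 := hdSC b hb a ha
      have h3 : Md * Real.sqrt (2 * breg h b a) ≤ 0 :=
        mul_nonpos_of_nonpos_of_nonneg hMd (Real.sqrt_nonneg _)
      linarith
    have hV0 : ∀ a ∈ Q, ∀ b ∈ Q, breg h b a = 0 := by
      intro a ha b hb
      have := hd1 a ha b hb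
      have := hd1 b hb a ha
      have := hV a b
      have := hV b a
      linarith
    have hl : ∑ t ∈ Finset.Icc 1 T, f t (x t) ≤ ∑ t ∈ Finset.Icc 1 T, f t xs := by
      refine Finset.sum_le_sum fun t ht => ?_
      have h1 := hfLip t ht (x t) (hxQ1 t ht) xs hxsQ
      rw [hV0 _ (hxQ1 t ht) _ hxsQ] at h1
      have h2 := romd_grad_ineq (hfdiff t) (hfconv t) (x t) xs
      rw [mul_zero, Real.sqrt_zero, mul_zero, add_zero] at h1
      linarith
    have hr : 0 ≤ (A2 + 2 * Md ^ 2) * (∑ s ∈ Finset.Icc 1 T, ls s) +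
          ∑ t ∈ Finset.Icc 1 T, (M t + ls t * Md) ^ 2 /
            ((∑ s ∈ Finset.Icc 1 t, μ s) + ∑ s ∈ Finset.Icc 1 t, ls s) :=
      add_nonneg (mul_nonneg hB0 (Finset.sum_nonneg hls))
        (Finset.sum_nonneg fun t ht => div_nonneg (sq_nonneg _) (hlsp t ht).le)
    linarith
  obtain ⟨B, hB⟩ : ∃ B, B = A2 + 2 * Md ^ 2 := ⟨_, rfl⟩
  have hBp : 0 < B := by rw [hB]; positivity
  rw [← hB] at hlam ⊢
  obtain ⟨m, hm⟩ : ∃ m : ℕ → ℝ, ∀ t, m t = ∑ s ∈ Finset.Icc 1 t, μ s := ⟨_, fun _ => rfl⟩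
  obtain ⟨La, hLa⟩ : ∃ m : ℕ → ℝ, ∀ t, m t = ∑ s ∈ Finset.Icc 1 t, lam s := ⟨_, fun _ => rfl⟩
  obtain ⟨Ls, hLs⟩ : ∃ m : ℕ → ℝ, ∀ t, m t = ∑ s ∈ Finset.Icc 1 t, ls s := ⟨_, fun _ => rfl⟩
  simp only [← hm, ← hLa, ← hLs] at hlam hpos hstep hlsp ⊢
  have hm1 : ∀ t, m (t + 1) = m t + μ (t + 1) := fun t => by
    simp only [hm, Finset.sum_Icc_succ_top (Nat.le_add_left 1 t)]
  have hLa1 : ∀ t, La (t + 1) = La t + lam (t + 1) := fun t => by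
    simp only [hLa, Finset.sum_Icc_succ_top (Nat.le_add_left 1 t)]
  have hm0 : m 0 = 0 := by simp [hm]
  have hLa0 : La 0 = 0 := by simp [hLa]
  have hLsmono : ∀ t ∈ Finset.Icc 1 T, Ls t ≤ Ls T := by
    intro t ht
    rw [hLs, hLs]
    refine Finset.sum_le_sum_of_subset_of_nonneg ?_ fun i hi _ => hls i hi
    exact Finset.Icc_subset_Icc le_rfl (Finset.mem_Icc.1 ht).2
  have hL0 : 0 ≤ Ls T := by rw [hLs]; exact Finset.sum_nonneg hls
  -- facts on lam
  have hlamf : ∀ t, t + 1 ∈ Finset.Icc 1 T → 0 ≤ lam (t + 1) ∧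
      B * lam (t + 1) * (m (t + 1) + La (t + 1)) = 2 * M (t + 1) ^ 2 := by
    intro t ht
    have h1 := hlam _ ht
    rw [Nat.add_sub_cancel] at h1
    rw [hLa1]
    set a := m (t + 1) + La t with ha
    have hq : 0 ≤ 8 * M (t + 1) ^ 2 / B := by positivity
    have hs := Real.sq_sqrt (show 0 ≤ a ^ 2 + 8 * M (t + 1) ^ 2 / B by positivity)
    have hs1 : a ≤ Real.sqrt (a ^ 2 + 8 * M (t + 1) ^ 2 / B) :=
      Real.le_sqrt_of_sq_le (by linarith)
    set w := Real.sqrt (a ^ 2 + 8 * M (t + 1) ^ 2 / B)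
    refine ⟨by linarith, ?_⟩
    have h2 : m (t + 1) + (La t + lam (t + 1)) = (w + a) / 2 := by rw [h1]; linarith
    rw [h2, h1]
    have h3 : B * (8 * M (t + 1) ^ 2 / B) = 8 * M (t + 1) ^ 2 := by field_simp
    have h4 : B * w ^ 2 = B * (a ^ 2 + 8 * M (t + 1) ^ 2 / B) := by rw [hs]
    linarith
  -- oscillation of d
  have hosc : ∀ a ∈ Q, ∀ b ∈ Q, d a - d b ≤ Md ^ 2 / 2 := by
    intro a ha b hb
    have h1 := hdLip a ha b hb
    have h2 := hdSC b hb a ha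
    have h3 := Real.sq_sqrt (show 0 ≤ 2 * breg h b a by linarith [hV a b])
    nlinarith [sq_nonneg (Real.sqrt (2 * breg h b a) - Md)]
  have main : ∀ n, n ≤ T → ∑ t ∈ Finset.Icc 1 n, (f t (x t) - f t xs) ≤
      B * (2 * min (Ls T) (La n)) + ∑ t ∈ Finset.Icc 1 n, 2 * M t ^ 2 / (m t + Ls T)
        - (m n + La n) * breg h xs (x (n + 1)) := by
    intro n
    induction n with
    | zero => intro _; simp [hm0, hLa0, hL0]
    | succ n ih =>
      intro hn
      have ih := ih (by omega)
      have ht : n + 1 ∈ Finset.Icc 1 T := Finset.mem_Icc.2 ⟨by omega, hn⟩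
      rw [Finset.sum_Icc_succ_top (Nat.le_add_left 1 n),
        Finset.sum_Icc_succ_top (Nat.le_add_left 1 n)]
      obtain ⟨hl0, hlM⟩ := hlamf n ht
      have hS := hpos _ ht
      have hw : 0 < m (n + 1) + Ls T := by linarith [hlsp _ ht, hLsmono _ ht]
      have hX := hxQ1 _ ht
      have hX' := hxQ2 _ ht
      have hst := romd_md_step hdiff hQconv hS hxsQ (hstep _ ht)
      have hfs := hfSC _ ht xs hxsQ _ hX
      have hds := hdSC xs hxsQ _ hX
      have hfl := hfLip _ ht _ hX _ hX'
      have hdl := hdLip _ hX _ hX'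
      have hdu := hdSC _ hX' _ hX
      have hsq := Real.sq_sqrt (show 0 ≤ 2 * breg h (x (n + 1 + 1)) (x (n + 1)) by
        linarith [hV (x (n + 1)) (x (n + 1 + 1))])
      have hu0 := Real.sqrt_nonneg (2 * breg h (x (n + 1 + 1)) (x (n + 1)))
      set u := Real.sqrt (2 * breg h (x (n + 1 + 1)) (x (n + 1)))
      have hu : u ^ 2 / 2 ≤ A2 + Md * u := by
        linarith [hA2' _ hX', hdnn _ hX]
      obtain ⟨b1, b2⟩ := romd_scalar_bound (De := d xs - d (x (n + 1))) hl0 hS hB hMd hA0 hlM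
        (by linarith [hA2' _ hxsQ, hdnn _ hX]) (hosc _ hxsQ _ hX) hu hu0
      have b3 := romd_scalar_step (L := Ls T) (L' := La n) (w := m (n + 1) + Ls T)
        (e := (lam (n + 1) * (d xs - d (x (n + 1))) + (M (n + 1) + lam (n + 1) * Md) * u -
          (m (n + 1) + La (n + 1)) * u ^ 2 / 2) / B) hl0 hS hw (by rw [hLa1]; ring)
        (by rw [div_le_iff₀ hBp]; linarith) (by rw [div_le_iff₀ hBp]; linarith)
      rw [← hLa1, div_le_iff₀ hBp, add_mul (2 * (_ - _)) _ B, div_mul_eq_mul_div] at b3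
      have e1 : lam (n + 1) * (m (n + 1) + La (n + 1)) * B = 2 * M (n + 1) ^ 2 := by
        rw [← hlM]; ring
      rw [e1] at b3
      have hS' : m (n + 1) + La (n + 1) = m n + La n + μ (n + 1) + lam (n + 1) := by
        rw [hm1, hLa1]; ring
      have e2 : breg h (x (n + 1 + 1)) (x (n + 1)) = u ^ 2 / 2 := by linarith
      rw [e2] at hst
      have hds' := mul_le_mul_of_nonneg_left hds hl0
      have hdl' := mul_nonneg hl0 hdl
      have e3 : (m (n + 1) + La (n + 1)) * breg h xs (x (n + 1)) =
        (m n + La n) * breg h xs (x (n + 1)) + (μ (n + 1) + lam (n + 1)) * breg h xs (x (n + 1)) := by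
        rw [hS']; ring
      have n1 : ∀ (v p q : E), ⟪v, p - q⟫ = - ⟪v, q - p⟫ := fun v p q => by
        rw [← inner_neg_right, neg_sub]
      rw [n1 _ (x (n + 1)) xs, n1 _ (x (n + 1)) (x (n + 1 + 1)), inner_add_left, inner_add_left,
        real_inner_smul_left, real_inner_smul_left] at hst
      linarith
  have hfin := main T le_rfl
  rw [Finset.sum_sub_distrib] at hfin
  have hTm : T ∈ Finset.Icc 1 T := Finset.mem_Icc.2 ⟨hT, le_rfl⟩
  have h1 := mul_nonneg (hpos T hTm).le (hV (x (T + 1)) xs)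
  have h2 : B * (2 * min (Ls T) (La T)) ≤ B * (2 * Ls T) := by
    have := min_le_left (Ls T) (La T)
    gcongr
  have h3 : ∑ t ∈ Finset.Icc 1 T, 2 * M t ^ 2 / (m t + Ls T) ≤
      2 * ∑ t ∈ Finset.Icc 1 T, (M t + ls t * Md) ^ 2 / (m t + Ls t) := by
    rw [Finset.mul_sum]
    refine Finset.sum_le_sum fun t ht => ?_
    rw [mul_div_assoc]
    have p1 := hlsp t ht
    have p2 := hLsmono t ht
    have p3 := hMnn t ht
    have p4 := mul_nonneg (hls t ht) hMd.le
    gcongr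
    linarith
  linarith
end
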